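/- (Generalized Gamma example.) Let a₁ > 6 and a₂ > 0, and let π_γ(x) = x^{a₁−1} exp(−x^{a₂}) 1_{(0,∞)}(x) / ∫_0^∞ y^{a₁−1} exp(−y^{a₂}) dy, with potential V_γ(x) = x^{a₂} − (a₁−1) log x and V̇_γ(x) = a₂ x^{a₂−1} − (a₁−1)/x on 𝓘 = (0,∞). Then π_γ satisfies assumption G1 with r = 3/2 and p = 5; explicitly: (i) there exist C > 0 and β > 1 such that for all θ ∈ ℝ, (∫_0^∞ |(V_γ(x+θ) − V_γ(x)) 1_{(0,∞)}(x + 3θ/2) 1_{(0,∞)}(x − θ/2) − θ V̇_γ(x)|⁵ π_γ(x) dx)^{1/5} ≤ C|θ|^β; (ii) ∫_0^∞ |V̇_γ(x)|⁶ π_γ(x) dx < ∞; (iii) there exists C > 0 such that for all θ ∈ ℝ, ∫ 1_{(0,∞)^c}(x+θ) π_γ(x) dx ≤ C|θ|^{a₁}. -/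

import Mathlib

open MeasureTheory ProbabilityTheory Filter Real
open scoped ENNReal NNReal Topology

noncomputable section

/-- Normalizing constant of the generalized Gamma density. -/
def gammaNorm (a1 a2 : ℝ) : ℝ :=
  ∫ y in Set.Ioi (0 : ℝ), y ^ (a1 - 1) * Real.exp (-(y ^ a2))

/-- The generalized Gamma density `π_γ`. -/
def gammaDen (a1 a2 : ℝ) (x : ℝ) : ℝ :=
  if 0 < x then x ^ (a1 - 1) * Real.exp (-(x ^ a2)) / gammaNorm a1 a2 else 0

/-- The potential `V_γ(x) = x^{a₂} - (a₁-1) log x`. -/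
def gammaV (a1 a2 : ℝ) (x : ℝ) : ℝ := x ^ a2 - (a1 - 1) * Real.log x

/-- `V̇_γ(x) = a₂ x^{a₂-1} - (a₁-1)/x`. -/
def gammaVdot (a1 a2 : ℝ) (x : ℝ) : ℝ := a2 * x ^ (a2 - 1) - (a1 - 1) / x

lemma taylor_aux (f f' f'' : ℝ → ℝ) (s : Set ℝ) (hs : Convex ℝ s) (hc : IsCompact s) (h0 : (0:ℝ) ∈ s)
    (hf : ∀ t ∈ s, HasDerivAt f (f' t) t) (hf' : ∀ t ∈ s, HasDerivAt f' (f'' t) t)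
    (hf'' : ContinuousOn f'' s) :
    ∃ K, 0 ≤ K ∧ ∀ t ∈ s, |f t - f 0 - f' 0 * t| ≤ K * t ^ 2 := by
  obtain ⟨K, hK⟩ := hc.exists_bound_of_continuousOn hf''
  have hK0 : 0 ≤ K := (norm_nonneg _).trans (hK 0 h0)
  have hl : ∀ t ∈ s, |f' t - f' 0| ≤ K * |t| := by
    intro t ht
    have := Convex.norm_image_sub_le_of_norm_hasDerivWithin_le
      (fun x hx => (hf' x hx).hasDerivWithinAt) hK hs h0 ht
    simpa using this
  refine ⟨K, hK0, fun t ht => ?_⟩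
  have hsub : Set.uIcc 0 t ⊆ s := hs.ordConnected.uIcc_subset h0 ht
  have := Convex.norm_image_sub_le_of_norm_hasDerivWithin_le (s := Set.uIcc 0 t)
    (f := fun u => f u - f' 0 * u) (f' := fun u => f' u - f' 0) (C := K * |t|) (x := 0) (y := t)
    (fun x hx => by
      have := ((hf x (hsub hx)).sub ((hasDerivAt_id x).const_mul (f' 0))).hasDerivWithinAt (s := Set.uIcc 0 t)
      simp only [mul_one] at this
      exact this)
    (fun x hx => by
      have h := Set.abs_sub_left_of_mem_uIcc hx
      simp only [sub_zero] at h
      exact (hl x (hsub hx)).trans (by gcongr))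
    (convex_uIcc 0 t) Set.left_mem_uIcc Set.right_mem_uIcc
  simp only [Real.norm_eq_abs, mul_zero, sub_zero] at this
  calc _ = |f t - f' 0 * t - f 0| := by ring_nf
    _ ≤ K * |t| * |t| := this
    _ = K * t^2 := by rw [mul_assoc, ← sq, sq_abs]

lemma taylor_rpow (a : ℝ) : ∃ K, 0 ≤ K ∧ ∀ t ∈ Set.Icc (-(2/3):ℝ) 2,
    |(1 + t) ^ a - 1 - a * t| ≤ K * t ^ 2 := by
  obtain ⟨K, hK, h⟩ := taylor_aux (fun t => (1 + t) ^ a) (fun t => a * (1 + t) ^ (a - 1))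
    (fun t => a * ((a - 1) * (1 + t) ^ (a - 1 - 1))) (Set.Icc (-(2/3):ℝ) 2) (convex_Icc _ _) isCompact_Icc
    (by constructor <;> norm_num)
    (fun t ht => by
      have : (1 + t) ≠ 0 := by linarith [ht.1]
      simpa using ((hasDerivAt_id t).const_add 1).rpow_const (p := a) (Or.inl this))
    (fun t ht => by
      have : (1 + t) ≠ 0 := by linarith [ht.1]
      simpa using (((hasDerivAt_id t).const_add 1).rpow_const (p := a - 1) (Or.inl this)).const_mul a)
    (by
      refine ContinuousOn.mul continuousOn_const (ContinuousOn.mul continuousOn_const ?_)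
      refine ContinuousOn.rpow_const (by fun_prop) (fun t ht => Or.inl ?_)
      linarith [ht.1])
  exact ⟨K, hK, fun t ht => by simpa using h t ht⟩

lemma taylor_log : ∃ K, 0 ≤ K ∧ ∀ t ∈ Set.Icc (-(2/3):ℝ) 2,
    |Real.log (1 + t) - t| ≤ K * t ^ 2 := by
  obtain ⟨K, hK, h⟩ := taylor_aux (fun t => Real.log (1 + t)) (fun t => (1 + t)⁻¹)
    (fun t => -1 / (1 + t) ^ 2) (Set.Icc (-(2/3):ℝ) 2) (convex_Icc _ _) isCompact_Icc
    (by constructor <;> norm_num)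
    (fun t ht => by
      have : (1 + t) ≠ 0 := by linarith [ht.1]
      simpa using ((hasDerivAt_id t).const_add 1).log this)
    (fun t ht => by
      have : (1 + t) ≠ 0 := by linarith [ht.1]
      have h := ((hasDerivAt_id t).const_add 1).inv this
      exact h)
    (by
      refine ContinuousOn.div continuousOn_const (by fun_prop) (fun t ht => ?_)
      have : 0 < (1 + t) := by linarith [ht.1]
      positivity)
  exact ⟨K, hK, fun t ht => by simpa using h t ht⟩

lemma vdot_bound (a1 a2 : ℝ) (h1 : 6 < a1) (h2 : 0 < a2) (x : ℝ) (hx : 0 < x) :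
    |gammaVdot a1 a2 x| ≤ (a1 + a2) * x⁻¹ * (1 + x ^ a2) := by
  have hp : 0 < x ^ a2 := rpow_pos_of_pos hx _
  have e : gammaVdot a1 a2 x = x⁻¹ * (a2 * x ^ a2 - (a1 - 1)) := by
    unfold gammaVdot
    rw [rpow_sub_one hx.ne']; field_simp
  rw [e, abs_mul, abs_of_pos (inv_pos.mpr hx)]
  have : |a2 * x ^ a2 - (a1 - 1)| ≤ (a1 + a2) * (1 + x ^ a2) := by
    rw [abs_le]; constructor <;> nlinarith [mul_pos h2 hp, mul_pos (by linarith : 0 < a1) hp]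
  calc _ ≤ x⁻¹ * ((a1 + a2) * (1 + x ^ a2)) := by gcongr
    _ = _ := by ring

lemma pointwise_bound (a1 a2 : ℝ) (h1 : 6 < a1) (h2 : 0 < a2) :
    ∃ K, 0 ≤ K ∧ ∀ θ x : ℝ, 0 < x →
      |(gammaV a1 a2 (x + θ) - gammaV a1 a2 x) *
            (if 0 < x + 3 * θ / 2 then 1 else 0) * (if 0 < x - θ / 2 then 1 else 0) -
          θ * gammaVdot a1 a2 x| ≤ K * |θ / x| ^ (6 / 5 : ℝ) * (1 + x ^ a2) := by
  obtain ⟨K1, hK1, hr⟩ := taylor_rpow a2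
  obtain ⟨K2, hK2, hl⟩ := taylor_log
  refine ⟨2 * (K1 + (a1 - 1) * K2) + 2 * (a1 + a2), ?_, ?_⟩
  · have := mul_nonneg (by linarith : 0 ≤ a1 - 1) hK2
    linarith
  intro θ x hx
  have hp : 0 < x ^ a2 := rpow_pos_of_pos hx _
  have hm : 0 ≤ (a1 - 1) * K2 := mul_nonneg (by linarith) hK2
  set t := θ / x with ht
  have hθ : θ = t * x := by rw [ht]; field_simp
  have hT : 0 ≤ |t| ^ (6/5:ℝ) := by positivity
  by_cases hg : 0 < x + 3 * θ / 2 ∧ 0 < x - θ / 2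
  · rw [if_pos hg.1, if_pos hg.2]
    have t1 : -(2/3) < t := by rw [ht, lt_div_iff₀ hx]; linarith [hg.1]
    have t2 : t < 2 := by rw [ht, div_lt_iff₀ hx]; linarith [hg.2]
    have hpos : 0 < 1 + t := by linarith
    have e : (gammaV a1 a2 (x + θ) - gammaV a1 a2 x) * 1 * 1 - θ * gammaVdot a1 a2 x
        = x ^ a2 * ((1 + t) ^ a2 - 1 - a2 * t) - (a1 - 1) * (Real.log (1 + t) - t) := by
      have hx' : x + θ = x * (1 + t) := by rw [hθ]; ring
      unfold gammaV gammaVdot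
      rw [hx', mul_rpow hx.le hpos.le, Real.log_mul hx.ne' hpos.ne', rpow_sub_one hx.ne', hθ]
      field_simp
      ring
    have b1 := hr t ⟨t1.le, t2.le⟩
    have b2 := hl t ⟨t1.le, t2.le⟩
    have b3 : t ^ 2 ≤ 2 * |t| ^ (6/5:ℝ) := by
      rw [← sq_abs]
      rcases eq_or_ne t 0 with h | h
      · simp [h]
      have hat : 0 < |t| := abs_pos.mpr h
      have : |t| ^ 2 = |t| ^ (4/5:ℝ) * |t| ^ (6/5:ℝ) := by
        rw [← rpow_add hat]; norm_num
      rw [this]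
      gcongr
      calc |t| ^ (4/5:ℝ) ≤ 2 ^ (4/5:ℝ) := by
            gcongr; rw [abs_le]; constructor <;> linarith
        _ ≤ 2 ^ (1:ℝ) := by apply rpow_le_rpow_of_exponent_le <;> norm_num
        _ = 2 := by norm_num
    rw [e]
    calc _ ≤ |x ^ a2 * ((1 + t) ^ a2 - 1 - a2 * t)| + |(a1 - 1) * (Real.log (1 + t) - t)| := abs_sub _ _
      _ = x ^ a2 * |(1 + t) ^ a2 - 1 - a2 * t| + (a1 - 1) * |Real.log (1 + t) - t| := by
        rw [abs_mul, abs_mul, abs_of_pos hp, abs_of_pos (by linarith : 0 < a1 - 1)]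
      _ ≤ x ^ a2 * (K1 * (2 * |t| ^ (6/5:ℝ))) + (a1 - 1) * (K2 * (2 * |t| ^ (6/5:ℝ))) := by
        have : 0 ≤ a1 - 1 := by linarith
        gcongr
        · exact b1.trans (by gcongr)
        · exact b2.trans (by gcongr)
      _ ≤ _ := by
        have q1 := mul_nonneg hm hT
        have q2 := mul_nonneg hK1 hT
        have q3 := mul_nonneg (mul_nonneg hm hT) hp.le
        have q4 := mul_nonneg (mul_nonneg (by linarith : 0 ≤ a1 + a2) hT) (by linarith : 0 ≤ 1 + x ^ a2)
        nlinarith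
  · have e : (gammaV a1 a2 (x + θ) - gammaV a1 a2 x) *
            (if 0 < x + 3 * θ / 2 then 1 else 0) * (if 0 < x - θ / 2 then 1 else 0) -
          θ * gammaVdot a1 a2 x = - (θ * gammaVdot a1 a2 x) := by
      rcases not_and_or.mp hg with h | h <;> simp [h]
    have hat : 2/3 ≤ |t| := by
      rcases not_and_or.mp hg with h | h
      · have : t ≤ -(2/3) := by rw [ht, div_le_iff₀ hx]; linarith
        rw [abs_of_neg (by linarith)]; linarith
      · have : 2 ≤ t := by rw [ht, le_div_iff₀ hx]; linarith
        rw [abs_of_pos (by linarith)]; linarith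
    have b : |t| ≤ 2 * |t| ^ (6/5:ℝ) := by
      have hpos : 0 < |t| := by linarith
      have e1 : |t| ^ (6/5:ℝ) = |t| * |t| ^ (1/5:ℝ) := by
        rw [← rpow_one_add' hpos.le (by norm_num)]; norm_num
      have : (1/2:ℝ) ≤ |t| ^ (1/5:ℝ) := by
        calc (1/2:ℝ) ≤ 2/3 := by norm_num
          _ = (2/3:ℝ) ^ (1:ℝ) := by norm_num
          _ ≤ (2/3:ℝ) ^ (1/5:ℝ) := by
            apply rpow_le_rpow_of_exponent_ge <;> norm_num
          _ ≤ _ := by gcongr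
      rw [e1]; nlinarith
    rw [e, abs_neg, abs_mul]
    have hv := vdot_bound a1 a2 h1 h2 x hx
    have hθ' : |θ| = |t| * x := by rw [hθ, abs_mul, abs_of_pos hx]
    calc |θ| * |gammaVdot a1 a2 x| ≤ (|t| * x) * ((a1 + a2) * x⁻¹ * (1 + x ^ a2)) := by
          rw [hθ']; gcongr
      _ = |t| * ((a1 + a2) * (1 + x ^ a2)) := by field_simp
      _ ≤ (2 * |t| ^ (6/5:ℝ)) * ((a1 + a2) * (1 + x ^ a2)) := by
        have : 0 ≤ a1 + a2 := by linarith
        gcongr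
      _ ≤ _ := by
        have q := mul_nonneg (mul_nonneg (by linarith : 0 ≤ 2 * (K1 + (a1 - 1) * K2)) hT) (by linarith : 0 ≤ 1 + x ^ a2)
        nlinarith

/-- dominating function -/
def domW (a1 a2 x : ℝ) : ℝ :=
  x ^ (a1 - 7) * Real.exp (-(x ^ a2)) + x ^ (a1 - 7 + 6 * a2) * Real.exp (-(x ^ a2))

lemma domW_int (a1 a2 : ℝ) (h1 : 6 < a1) (h2 : 0 < a2) :
    IntegrableOn (domW a1 a2) (Set.Ioi 0) :=
  (integrableOn_rpow_mul_exp_neg_rpow (by linarith) h2).add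
    (integrableOn_rpow_mul_exp_neg_rpow (by linarith) h2)

lemma gammaNorm_nonneg (a1 a2 : ℝ) : 0 ≤ gammaNorm a1 a2 :=
  setIntegral_nonneg measurableSet_Ioi (fun x hx => by
    have : (0:ℝ) < x := hx
    positivity)

lemma domW_bound (a1 a2 x : ℝ) (hx : 0 < x) (n : ℕ) (hn : n ≤ 6) :
    x⁻¹ ^ 6 * (1 + x ^ a2) ^ n * gammaDen a1 a2 x ≤ 32 / gammaNorm a1 a2 * domW a1 a2 x := by
  have hZ := gammaNorm_nonneg a1 a2
  have hp : 0 < x ^ a2 := rpow_pos_of_pos hx _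
  have b : (1 + x ^ a2) ^ n ≤ 32 * (1 + (x ^ a2) ^ 6) := by
    calc _ ≤ (1 + x ^ a2) ^ 6 := pow_le_pow_right₀ (by linarith) hn
      _ ≤ 2 ^ (6 - 1) * (1 ^ 6 + (x ^ a2) ^ 6) := add_pow_le (by norm_num) hp.le 6
      _ = _ := by norm_num
  have e1 : x ^ (a1 - 7) = x⁻¹ ^ 6 * x ^ (a1 - 1) := by
    rw [show a1 - 7 = (a1 - 1) - (6:ℕ) by push_cast; ring, rpow_sub_natCast hx.ne']
    field_simp
  have e2 : x ^ (a1 - 7 + 6 * a2) = x⁻¹ ^ 6 * x ^ (a1 - 1) * (x ^ a2) ^ 6 := by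
    rw [rpow_add hx, e1, ← rpow_mul_natCast hx.le]; congr 2; push_cast; ring
  unfold gammaDen domW
  rw [if_pos hx, e1, e2]
  calc _ ≤ x⁻¹ ^ 6 * (32 * (1 + (x ^ a2) ^ 6)) * (x ^ (a1 - 1) * Real.exp (-(x ^ a2)) / gammaNorm a1 a2) := by
        gcongr
    _ = _ := by ring

lemma gammaDen_nonneg (a1 a2 x : ℝ) : 0 ≤ gammaDen a1 a2 x := by
  have := gammaNorm_nonneg a1 a2
  unfold gammaDen; split_ifs
  · positivity
  · rfl

lemma part1 (a1 a2 : ℝ) (h1 : 6 < a1) (h2 : 0 < a2) :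
    (∃ C > 0, ∃ β > (1 : ℝ), ∀ θ : ℝ,
      (∫ x in Set.Ioi (0 : ℝ),
        |(gammaV a1 a2 (x + θ) - gammaV a1 a2 x) *
            (if 0 < x + 3 * θ / 2 then 1 else 0) * (if 0 < x - θ / 2 then 1 else 0) -
          θ * gammaVdot a1 a2 x| ^ (5 : ℝ) * gammaDen a1 a2 x) ^ (1 / (5 : ℝ)) ≤
        C * |θ| ^ β) := by
  obtain ⟨K, hK, hb⟩ := pointwise_bound a1 a2 h1 h2
  have hZ := gammaNorm_nonneg a1 a2
  set M := ∫ x in Set.Ioi (0:ℝ), domW a1 a2 x with hM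
  have hM0 : 0 ≤ M := setIntegral_nonneg measurableSet_Ioi (fun x hx => by
    have : (0:ℝ) < x := hx
    unfold domW; positivity)
  set D := K ^ 5 * (32 / gammaNorm a1 a2) * M with hD
  have hD0 : 0 ≤ D := by positivity
  refine ⟨D ^ (1 / (5:ℝ)) + 1, by positivity, 6/5, by norm_num, fun θ => ?_⟩
  have key : (∫ x in Set.Ioi (0 : ℝ),
        |(gammaV a1 a2 (x + θ) - gammaV a1 a2 x) *
            (if 0 < x + 3 * θ / 2 then 1 else 0) * (if 0 < x - θ / 2 then 1 else 0) -
          θ * gammaVdot a1 a2 x| ^ (5 : ℝ) * gammaDen a1 a2 x) ≤ D * |θ| ^ (6:ℝ) := by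
    calc _ ≤ ∫ x in Set.Ioi (0 : ℝ), (K ^ 5 * (32 / gammaNorm a1 a2) * |θ| ^ (6:ℝ)) * domW a1 a2 x := by
          refine integral_mono_of_nonneg (Eventually.of_forall fun x => ?_)
            ((domW_int a1 a2 h1 h2).const_mul _) ?_
          · exact mul_nonneg (by positivity) (gammaDen_nonneg _ _ _)
          · filter_upwards [ae_restrict_mem measurableSet_Ioi] with x hx
            have hx : (0:ℝ) < x := hx
            have hp : 0 < x ^ a2 := rpow_pos_of_pos hx _
            have hd := gammaDen_nonneg a1 a2 x
            have e : (K * |θ / x| ^ (6 / 5 : ℝ) * (1 + x ^ a2)) ^ (5:ℝ) =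
                K ^ 5 * |θ| ^ (6:ℝ) * (x⁻¹ ^ 6 * (1 + x ^ a2) ^ 5) := by
              rw [mul_rpow (by positivity) (by positivity), mul_rpow hK (by positivity),
                ← rpow_mul (abs_nonneg _), abs_div, abs_of_pos hx, div_eq_mul_inv,
                show (6/5*5:ℝ) = (6:ℕ) by norm_num, show (5:ℝ) = (5:ℕ) by norm_num,
                show (6:ℝ) = (6:ℕ) by norm_num]
              simp only [rpow_natCast]
              ring
            calc _ ≤ (K * |θ / x| ^ (6 / 5 : ℝ) * (1 + x ^ a2)) ^ (5:ℝ) * gammaDen a1 a2 x := by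
                  gcongr
                  exact hb θ x hx
              _ = K ^ 5 * |θ| ^ (6:ℝ) * (x⁻¹ ^ 6 * (1 + x ^ a2) ^ 5 * gammaDen a1 a2 x) := by rw [e]; ring
              _ ≤ K ^ 5 * |θ| ^ (6:ℝ) * (32 / gammaNorm a1 a2 * domW a1 a2 x) := by
                exact mul_le_mul_of_nonneg_left (domW_bound a1 a2 x hx 5 (by norm_num)) (by positivity)
              _ = _ := by ring
      _ = _ := by rw [integral_const_mul, ← hM, hD]; ring
  calc _ ≤ (D * |θ| ^ (6:ℝ)) ^ (1 / (5:ℝ)) := by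
        refine rpow_le_rpow (integral_nonneg fun x => ?_) key (by norm_num)
        exact mul_nonneg (by positivity) (gammaDen_nonneg _ _ _)
    _ = D ^ (1 / (5:ℝ)) * |θ| ^ (6/5:ℝ) := by
        rw [mul_rpow hD0 (by positivity), ← rpow_mul (abs_nonneg _)]; norm_num
    _ ≤ _ := by gcongr; linarith

lemma part2 (a1 a2 : ℝ) (h1 : 6 < a1) (h2 : 0 < a2) :
    (IntegrableOn (fun x => |gammaVdot a1 a2 x| ^ (6 : ℝ) * gammaDen a1 a2 x)
      (Set.Ioi (0 : ℝ))) := by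
  refine Integrable.mono' (((domW_int a1 a2 h1 h2).const_mul ((a1 + a2) ^ 6 * (32 / gammaNorm a1 a2)))) ?_ ?_
  · apply Measurable.aestronglyMeasurable
    have m1 : Measurable (gammaVdot a1 a2) := by unfold gammaVdot; fun_prop
    have m2 : Measurable (gammaDen a1 a2) := by
      unfold gammaDen
      exact Measurable.ite measurableSet_Ioi (by fun_prop) (by fun_prop)
    have m3 : Measurable fun x => |gammaVdot a1 a2 x| := m1.abs
    fun_prop
  · filter_upwards [ae_restrict_mem measurableSet_Ioi] with x hx
    have hx : (0:ℝ) < x := hx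
    have hp : 0 < x ^ a2 := rpow_pos_of_pos hx _
    have hd := gammaDen_nonneg a1 a2 x
    rw [Real.norm_eq_abs, abs_of_nonneg (mul_nonneg (by positivity) hd),
      show (6:ℝ) = (6:ℕ) by norm_num, rpow_natCast]
    calc _ ≤ ((a1 + a2) * x⁻¹ * (1 + x ^ a2)) ^ 6 * gammaDen a1 a2 x := by
          gcongr
          exact vdot_bound a1 a2 h1 h2 x hx
      _ = (a1 + a2) ^ 6 * (x⁻¹ ^ 6 * (1 + x ^ a2) ^ 6 * gammaDen a1 a2 x) := by ring
      _ ≤ (a1 + a2) ^ 6 * (32 / gammaNorm a1 a2 * domW a1 a2 x) := by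
          have : 0 ≤ a1 + a2 := by linarith
          exact mul_le_mul_of_nonneg_left (domW_bound a1 a2 x hx 6 le_rfl) (by positivity)
      _ = _ := by ring

lemma part3 (a1 a2 : ℝ) (h1 : 6 < a1) (h2 : 0 < a2) :
    (∃ C > 0, ∀ θ : ℝ,
      ∫ x in Set.Ioi (0 : ℝ), (if x + θ ≤ 0 then 1 else 0) * gammaDen a1 a2 x ≤
        C * |θ| ^ a1) := by
  have hZ := gammaNorm_nonneg a1 a2
  refine ⟨1 / gammaNorm a1 a2 / a1 + 1, by positivity, fun θ => ?_⟩
  have hi : IntegrableOn (fun x : ℝ => x ^ (a1 - 1)) (Set.Ioc 0 |θ|) :=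
    (intervalIntegral.intervalIntegrable_rpow' (by linarith : -1 < a1 - 1)).1
  calc _ ≤ ∫ x in Set.Ioi (0 : ℝ), (Set.Ioc 0 |θ|).indicator
          (fun x => 1 / gammaNorm a1 a2 * x ^ (a1 - 1)) x := by
        refine integral_mono_of_nonneg (Eventually.of_forall fun x => ?_) ?_ ?_
        · exact mul_nonneg (by split_ifs <;> norm_num) (gammaDen_nonneg _ _ _)
        · exact ((integrable_indicator_iff measurableSet_Ioc).mpr (hi.const_mul _)).integrableOn
        · filter_upwards [ae_restrict_mem measurableSet_Ioi] with x hx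
          have hx : (0:ℝ) < x := hx
          split_ifs with h
          · have hm : x ∈ Set.Ioc 0 |θ| := ⟨hx, by linarith [neg_abs_le θ]⟩
            rw [Set.indicator_of_mem hm, gammaDen, if_pos hx, one_mul]
            have : Real.exp (-(x ^ a2)) ≤ 1 := Real.exp_le_one_iff.mpr (by have := rpow_pos_of_pos hx a2; linarith)
            calc _ ≤ x ^ (a1 - 1) * 1 / gammaNorm a1 a2 := by gcongr
              _ = _ := by ring
          · rw [zero_mul]
            refine Set.indicator_nonneg (fun y hy => ?_) x
            have := hy.1
            positivity
    _ = 1 / gammaNorm a1 a2 * (|θ| ^ a1 / a1) := by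
        rw [setIntegral_indicator measurableSet_Ioc,
          Set.inter_eq_self_of_subset_right Set.Ioc_subset_Ioi_self, integral_const_mul,
          ← intervalIntegral.integral_of_le (abs_nonneg _), integral_rpow (Or.inl (by linarith)),
          sub_add_cancel, zero_rpow (by linarith), sub_zero]
    _ = 1 / gammaNorm a1 a2 / a1 * |θ| ^ a1 := by ring
    _ ≤ _ := by gcongr; linarith

/-- Generalized Gamma example: `π_γ` satisfies assumption G1 with `r = 3/2` and
`p = 5`: (i) the `L⁵` mean-differentiability bound, (ii) `‖V̇_γ‖_{π,6} < ∞`,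
(iii) the boundary mass bound with exponent `a₁`. -/
theorem stmt_19 (a1 a2 : ℝ) (h1 : 6 < a1) (h2 : 0 < a2) :
    (∃ C > 0, ∃ β > (1 : ℝ), ∀ θ : ℝ,
      (∫ x in Set.Ioi (0 : ℝ),
        |(gammaV a1 a2 (x + θ) - gammaV a1 a2 x) *
            (if 0 < x + 3 * θ / 2 then 1 else 0) * (if 0 < x - θ / 2 then 1 else 0) -
          θ * gammaVdot a1 a2 x| ^ (5 : ℝ) * gammaDen a1 a2 x) ^ (1 / (5 : ℝ)) ≤
        C * |θ| ^ β) ∧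
    (IntegrableOn (fun x => |gammaVdot a1 a2 x| ^ (6 : ℝ) * gammaDen a1 a2 x)
      (Set.Ioi (0 : ℝ))) ∧
    (∃ C > 0, ∀ θ : ℝ,
      ∫ x in Set.Ioi (0 : ℝ), (if x + θ ≤ 0 then 1 else 0) * gammaDen a1 a2 x ≤
        C * |θ| ^ a1) := by
  exact ⟨part1 a1 a2 h1 h2, part2 a1 a2 h1 h2, part3 a1 a2 h1 h2⟩
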